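/- arXiv:1902.02473 — 3 statements merged into one kernel-verified Lean document; each statement's English description precedes it below -/
import Mathlib

section
/- Let n be a positive integer and let βₙ be a positive real root of the equation (e^(1+n) − x(n−1))² − (e^(2+2n)·n − x²·n + x·e^(1+n)·(1 − n + n²))·ln(e + e^(−n)·x) = 0 in the unknown x. Let β be a real number with β > βₙ, and let p ∈ H₁ with p(z) ≠ 0 for all z ∈ 𝔻. If the function z ↦ p(z) + β·z·p′(z)/p(z)^(n+1) is subordinate to z ↦ e^z on 𝔻, then p is subordinate to z ↦ e^z on 𝔻. -/
open Complex

noncomputable section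

/-- The open unit disk in the complex plane. -/
def unitDisk : Set ℂ := Metric.ball 0 1

/-- `f` is subordinate to `g` on the open unit disk: there is an analytic
Schwarz function `w` with `w 0 = 0`, `‖w z‖ < 1` on the disk, and `f = g ∘ w`. -/
def Subord (f g : ℂ → ℂ) : Prop :=
  ∃ w : ℂ → ℂ, DifferentiableOn ℂ w unitDisk ∧ w 0 = 0 ∧
    (∀ z ∈ unitDisk, ‖w z‖ < 1) ∧ ∀ z ∈ unitDisk, f z = g (w z)

/-- A nonvanishing holomorphic function on the unit disk with value `1` at `0` has a holomorphic
logarithm vanishing at `0`. -/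
lemma exists_log_of_ne_zero {p : ℂ → ℂ} (hp : DifferentiableOn ℂ p unitDisk) (hp0 : p 0 = 1)
    (hpne : ∀ z ∈ unitDisk, p z ≠ 0) :
    ∃ w : ℂ → ℂ, DifferentiableOn ℂ w unitDisk ∧ w 0 = 0 ∧ ∀ z ∈ unitDisk, p z = exp (w z) := by
  have hopen : IsOpen unitDisk := Metric.isOpen_ball
  have hdiff : DifferentiableOn ℂ (fun z => deriv p z / p z) unitDisk :=
    (hp.deriv hopen).div hp hpne
  obtain ⟨w, hw0, hw⟩ := (DifferentiableOn.isExactOn_ball hdiff).with_val_at 0 0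
  have h0 : (0 : ℂ) ∈ unitDisk := Metric.mem_ball_self one_pos
  refine ⟨w, fun z hz => (hw z hz).differentiableAt.differentiableWithinAt, hw0, fun z hz => ?_⟩
  have hder : ∀ x ∈ unitDisk, HasDerivAt (fun x => p x * exp (-w x)) 0 x := by
    intro x hx
    have hpx := (hp.differentiableAt (hopen.mem_nhds hx)).hasDerivAt
    refine (hpx.mul (hw x hx).neg.cexp).congr_deriv ?_
    have := hpne x hx
    field_simp
    ring
  have hconst : p z * exp (-w z) = p 0 * exp (-w 0) :=
    hopen.is_const_of_deriv_eq_zero (convex_ball 0 1).isPreconnected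
      (fun x hx => (hder x hx).differentiableAt.differentiableWithinAt)
      (fun x hx => (hder x hx).deriv) hz h0
  rw [hw0, hp0, neg_zero, Complex.exp_zero, mul_one, Complex.exp_neg] at hconst
  exact (mul_inv_eq_one₀ (Complex.exp_ne_zero _)).1 hconst

/-- A function on the disk that vanishes at `0` and leaves the unit disk does so for the first time
at some point `z₀`: it is bounded by `1` on the closed disk through `z₀`. -/
lemma exists_first_exit {w : ℂ → ℂ} (hw : DifferentiableOn ℂ w unitDisk) (hw0 : w 0 = 0)
    (hex : ∃ z ∈ unitDisk, 1 ≤ ‖w z‖) :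
    ∃ z₀ ∈ unitDisk, z₀ ≠ 0 ∧ ‖w z₀‖ = 1 ∧ ∀ z, ‖z‖ ≤ ‖z₀‖ → ‖w z‖ ≤ 1 := by
  obtain ⟨z₁, hz₁, h₁⟩ := hex
  have hz₁' : ‖z₁‖ < 1 := mem_ball_zero_iff.1 hz₁
  have hsub : Metric.closedBall (0 : ℂ) ‖z₁‖ ⊆ unitDisk := Metric.closedBall_subset_ball hz₁'
  have hcompact : IsCompact (Metric.closedBall (0 : ℂ) ‖z₁‖ ∩ (fun z => ‖w z‖) ⁻¹' Set.Ici 1) :=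
    (isCompact_closedBall (0 : ℂ) ‖z₁‖).of_isClosed_subset
      ((hw.continuousOn.mono hsub).norm.preimage_isClosed_of_isClosed
        Metric.isClosed_closedBall isClosed_Ici) Set.inter_subset_left
  obtain ⟨z₀, ⟨hz₀, hge⟩, hmin⟩ := hcompact.exists_isMinOn
    ⟨z₁, mem_closedBall_zero_iff.2 le_rfl, h₁⟩ continuous_norm.continuousOn
  have hge : 1 ≤ ‖w z₀‖ := hge
  have hne : z₀ ≠ 0 := by
    rintro rfl
    rw [hw0, norm_zero] at hge
    linarith
  have hz₀' : ‖z₀‖ ≤ ‖z₁‖ := mem_closedBall_zero_iff.1 hz₀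
  have hlt : ∀ z ∈ Metric.ball (0 : ℂ) ‖z₀‖, ‖w z‖ ≤ 1 := by
    intro z hz
    rw [mem_ball_zero_iff] at hz
    by_contra! h
    exact absurd (hmin ⟨mem_closedBall_zero_iff.2 (hz.le.trans hz₀'), h.le⟩) (not_le.2 hz)
  have hle : ∀ z, ‖z‖ ≤ ‖z₀‖ → ‖w z‖ ≤ 1 := by
    intro z hz
    have hcl : closure (Metric.ball (0 : ℂ) ‖z₀‖) = Metric.closedBall 0 ‖z₀‖ :=
      closure_ball 0 (norm_ne_zero_iff.2 hne)
    refine le_on_closure (f := fun z => ‖w z‖) hlt ?_ continuousOn_const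
      (hcl ▸ mem_closedBall_zero_iff.2 hz)
    rw [hcl]
    exact (hw.continuousOn.mono ((Metric.closedBall_subset_closedBall hz₀').trans hsub)).norm
  exact ⟨z₀, hsub hz₀, hne, le_antisymm (hle z₀ le_rfl) hge, hle⟩

/-- **Jack's lemma**. -/
lemma jack {w : ℂ → ℂ} (hw : DifferentiableOn ℂ w unitDisk) (hw0 : w 0 = 0) {z₀ : ℂ}
    (hz₀ : z₀ ∈ unitDisk) (hne : z₀ ≠ 0) (hnorm : ‖w z₀‖ = 1)
    (hle : ∀ z, ‖z‖ ≤ ‖z₀‖ → ‖w z‖ ≤ 1) :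
    ∃ k : ℝ, 1 ≤ k ∧ z₀ * deriv w z₀ = k * w z₀ := by
  have hpos : 0 < ‖z₀‖ := norm_pos_iff.2 hne
  have hderiv : HasDerivAt w (deriv w z₀) z₀ :=
    (hw.differentiableAt (Metric.isOpen_ball.mem_nhds hz₀)).hasDerivAt
  set c : ℂ := (starRingEnd ℂ) (w z₀) with hc
  have hcw : c * w z₀ = 1 := by
    rw [hc, mul_comm, Complex.mul_conj, Complex.normSq_eq_norm_sq, hnorm]
    simp
  have hcn : ‖c‖ = 1 := by rw [hc, RCLike.norm_conj, hnorm]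
  have hrele : ∀ z, (c * w z).re ≤ ‖w z‖ := fun z =>
    (Complex.re_le_norm _).trans (by rw [norm_mul, hcn, one_mul])
  set q : ℂ := c * (z₀ * deriv w z₀) with hq
  have him : q.im = 0 := by
    have hrot : HasDerivAt (fun t : ℂ => z₀ * exp (t * I)) (z₀ * I) ((0 : ℝ) : ℂ) := by
      have := (((hasDerivAt_id ((0 : ℝ) : ℂ)).mul_const I).cexp).const_mul z₀
      simpa using this
    have hcomp : HasDerivAt (fun t : ℂ => c * w (z₀ * exp (t * I))) (c * (deriv w z₀ * (z₀ * I)))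
        ((0 : ℝ) : ℂ) := by
      refine (HasDerivAt.comp _ ?_ hrot).const_mul c
      simpa using hderiv
    have hmax : IsLocalMax (fun t : ℝ => (c * w (z₀ * exp ((t : ℂ) * I))).re) 0 := by
      refine Filter.Eventually.of_forall fun t => ?_
      refine (hrele _).trans ((hle _ ?_).trans ?_)
      · rw [norm_mul, Complex.norm_exp_ofReal_mul_I, mul_one]
      · simp [hcw]
    have h := hmax.hasDerivAt_eq_zero hcomp.real_of_complex
    have : c * (deriv w z₀ * (z₀ * I)) = q * I := by rw [hq]; ring
    rw [this, Complex.mul_I_re] at h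
    linarith
  have hre : 1 ≤ q.re := by
    have hray : HasDerivAt (fun s : ℂ => s * z₀) z₀ ((1 : ℝ) : ℂ) := by
      simpa using (hasDerivAt_id ((1 : ℝ) : ℂ)).mul_const z₀
    have hcomp : HasDerivAt (fun s : ℂ => c * w (s * z₀)) (c * (deriv w z₀ * z₀))
        ((1 : ℝ) : ℂ) := by
      refine (HasDerivAt.comp _ ?_ hray).const_mul c
      simpa using hderiv
    have hslope := (hasDerivAt_iff_tendsto_slope.1 hcomp.real_of_complex).mono_left
      (nhdsWithin_mono (1 : ℝ) (fun x (hx : x ∈ Set.Iio (1 : ℝ)) => ne_of_lt hx))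
    have hqe : c * (deriv w z₀ * z₀) = q := by rw [hq]; ring
    rw [hqe] at hslope
    refine ge_of_tendsto hslope ?_
    filter_upwards [Ioo_mem_nhdsLT (zero_lt_one' ℝ)] with s hs
    have hsz : ‖(s : ℂ) * z₀‖ = s * ‖z₀‖ := by
      rw [norm_mul, Complex.norm_of_nonneg hs.1.le]
    have hschwarz := Complex.dist_le_div_mul_dist_of_mapsTo_ball (f := w) (c := 0) (R₁ := ‖z₀‖)
      (R₂ := 1) (z := s * z₀)
      (hw.mono (Metric.ball_subset_ball (mem_ball_zero_iff.1 hz₀).le))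
      (fun z hz => by
        rw [hw0, mem_closedBall_zero_iff]
        exact hle z (mem_ball_zero_iff.1 hz).le)
      (by rw [mem_ball_zero_iff, hsz]; nlinarith [hs.2])
    rw [hw0, dist_zero_right, dist_zero_right, hsz] at hschwarz
    have hs' : (c * w (s * z₀)).re ≤ s := by
      refine (hrele _).trans (hschwarz.trans_eq ?_)
      field_simp
    rw [slope_def_field, le_div_iff_of_neg (by linarith [hs.2])]
    simp only [ofReal_one, one_mul, hcw, one_re]
    linarith
  refine ⟨q.re, hre, ?_⟩
  have hqr : (q.re : ℂ) = q := Complex.ext (by simp) (by simp [him])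
  rw [hqr, hq]
  linear_combination (-(z₀ * deriv w z₀)) * hcw

/-- On the unit circle, `exp ζ + b ζ exp (-n ζ)` has modulus at least `e` once `b` is large: either
the second summand dominates, or the two summands enclose an angle of at most `π / 2`. -/
lemma exp_one_le_norm_boundary {n : ℕ} (hn : 0 < n) {y b : ℝ} (hy : 1 ≤ y)
    (hy2 : n = 2 → 3 / 2 ≤ y) (hy3 : 3 ≤ n → 2 ≤ y) (hb : y * Real.exp (1 + n) ≤ b)
    {ζ : ℂ} (hζ : ‖ζ‖ = 1) :
    Real.exp 1 ≤ ‖exp ζ + b * ζ * exp (-(n * ζ))‖ := by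
  have hn1 : (1 : ℝ) ≤ n := by exact_mod_cast hn
  have hbpos : 0 < b := lt_of_lt_of_le (by positivity) hb
  set θ := arg ζ with hθ
  have hζe : ζ = exp (θ * I) := by
    have := Complex.norm_mul_exp_arg_mul_I ζ
    rw [hζ] at this
    simpa using this.symm
  have hre : ζ.re = Real.cos θ := by rw [hζe, Complex.exp_ofReal_mul_I_re]
  have him : ζ.im = Real.sin θ := by rw [hζe, Complex.exp_ofReal_mul_I_im]
  set x := Real.cos θ with hx
  have hx1 : x ≤ 1 := Real.cos_le_one θ
  have hnu : ‖exp ζ‖ = Real.exp x := by rw [Complex.norm_exp, hre]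
  have hnv : ‖(b : ℂ) * ζ * exp (-(n * ζ))‖ = b * Real.exp (-(n * x)) := by
    rw [norm_mul, norm_mul, hζ, Complex.norm_of_nonneg hbpos.le, Complex.norm_exp]
    simp [hre]
  have hvlow : Real.exp 1 * (y * Real.exp (n * (1 - x))) ≤ b * Real.exp (-(n * x)) := by
    calc Real.exp 1 * (y * Real.exp (n * (1 - x)))
        = y * Real.exp (1 + n) * Real.exp (-(n * x)) := by
          rw [show Real.exp 1 * (y * Real.exp (n * (1 - x))) =
            y * (Real.exp 1 * Real.exp (n * (1 - x))) by ring, mul_assoc, ← Real.exp_add,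
            ← Real.exp_add]
          ring_nf
      _ ≤ _ := by gcongr
  have hge : y * (1 + n * (1 - x)) ≤ y * Real.exp (n * (1 - x)) := by
    have := Real.add_one_le_exp (n * (1 - x))
    gcongr
    linarith
  by_cases hfar : 2 ≤ y * (1 + n * (1 - x))
  · have h1 : ‖(b : ℂ) * ζ * exp (-(n * ζ))‖ - ‖exp ζ‖ ≤ ‖exp ζ + b * ζ * exp (-(n * ζ))‖ := by
      rw [add_comm]
      exact norm_sub_le_norm_add _ _
    have h2 : Real.exp x ≤ Real.exp 1 := Real.exp_le_exp.2 hx1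
    have h3 : Real.exp 1 * 2 ≤ Real.exp 1 * (y * Real.exp (n * (1 - x))) := by
      gcongr
      linarith
    rw [hnu, hnv] at h1
    linarith
  · have hangle : n * |θ| ≤ Real.pi / 2 := by
      have hcases : n = 1 ∨ n = 2 := by
        by_contra hne
        have := hy3 (by omega)
        nlinarith [mul_nonneg (by linarith : (0 : ℝ) ≤ n) (by linarith : 0 ≤ 1 - x)]
      rcases hcases with rfl | rfl
      · have hxpos : 0 ≤ x := by
          push_cast at hfar
          nlinarith
        rw [Nat.cast_one, one_mul, hθ]
        exact Complex.abs_arg_le_pi_div_two_iff.2 (hre ▸ hxpos)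
      · have hxlow : 5 / 6 ≤ x := by
          have := hy2 rfl
          push_cast at hfar
          nlinarith
        have hquarter : |θ| ≤ Real.pi / 4 := by
          by_contra! hlt
          have hcoslt := Real.cos_lt_cos_of_nonneg_of_le_pi (by positivity) (abs_arg_le_pi ζ) hlt
          rw [← hθ, Real.cos_abs, Real.cos_pi_div_four, ← hx] at hcoslt
          nlinarith [Real.sq_sqrt (zero_le_two (α := ℝ)), Real.sqrt_nonneg 2]
        push_cast
        linarith
    have hcos : 0 ≤ Real.cos (θ - (n + 1) * Real.sin θ) := by
      have hsin : ∀ t : ℝ, 0 ≤ t → n * t ≤ Real.pi / 2 →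
          0 ≤ Real.cos (t - (n + 1) * Real.sin t) := by
        intro t ht htn
        have hle := Real.sin_le ht
        have hnt : t ≤ n * t := le_mul_of_one_le_left ht hn1
        have hs := Real.sin_nonneg_of_nonneg_of_le_pi ht (by linarith [Real.pi_pos])
        exact Real.cos_nonneg_of_neg_pi_div_two_le_of_le (by nlinarith) (by nlinarith)
      have h := hsin |θ| (abs_nonneg θ) hangle
      rcases abs_choice θ with habs | habs <;> rw [habs] at h
      · exact h
      · rw [Real.sin_neg, ← Real.cos_neg] at h
        convert! h using 2
        ring
    have hinner : 0 ≤ inner ℝ (exp ζ) (b * ζ * exp (-(n * ζ))) := by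
      have hprod : b * ζ * exp (-(n * ζ)) * (starRingEnd ℂ) (exp ζ) =
          b * exp (θ * I + (-(n * ζ) + (starRingEnd ℂ) ζ)) := by
        rw [Complex.exp_add, Complex.exp_add, ← hζe, Complex.exp_conj]
        ring
      rw [Complex.inner, hprod, Complex.re_ofReal_mul, Complex.exp_re]
      have harg : (θ * I + (-(n * ζ) + (starRingEnd ℂ) ζ)).im = θ - (n + 1) * Real.sin θ := by
        simp [him]
        ring
      rw [harg]
      positivity
    have hsq : ‖(b : ℂ) * ζ * exp (-(n * ζ))‖ ≤ ‖exp ζ + b * ζ * exp (-(n * ζ))‖ := by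
      have := norm_add_sq_real (exp ζ) (b * ζ * exp (-(n * ζ)))
      refine le_of_sq_le_sq ?_ (norm_nonneg _)
      nlinarith [sq_nonneg ‖exp ζ‖]
    have h1 : 1 ≤ y * Real.exp (n * (1 - x)) := by nlinarith [mul_nonneg (by linarith : 0 ≤ (n:ℝ)) (by linarith : 0 ≤ 1 - x)]
    have h2 : Real.exp 1 ≤ Real.exp 1 * (y * Real.exp (n * (1 - x))) :=
      le_mul_of_one_le_right (Real.exp_pos 1).le h1
    rw [hnv] at hsq
    linarith

lemma half_le_log_one_add {y : ℝ} (h0 : 0 ≤ y) (h2 : y ≤ 2) : y / 2 ≤ Real.log (1 + y) := by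
  rw [Real.le_log_iff_exp_le (by linarith)]
  have h := convexOn_exp.2 (Set.mem_univ 0) (Set.mem_univ 1)
    (by linarith : 0 ≤ 1 - y / 2) (by linarith : 0 ≤ y / 2) (by ring)
  simp only [smul_eq_mul, mul_zero, mul_one, zero_add, Real.exp_zero] at h
  nlinarith [Real.exp_one_lt_three]

/-- The normalised equation for `y = βₙ / exp (1 + n)`. -/
lemma normalized_root {n : ℕ} {y : ℝ} (hy : 0 < y)
    (hroot : (Real.exp (1 + (n : ℝ)) - y * Real.exp (1 + (n : ℝ)) * ((n : ℝ) - 1)) ^ 2 -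
        (Real.exp (2 + 2 * (n : ℝ)) * (n : ℝ) - (y * Real.exp (1 + (n : ℝ))) ^ 2 * (n : ℝ) +
          y * Real.exp (1 + (n : ℝ)) * Real.exp (1 + (n : ℝ)) * (1 - (n : ℝ) + (n : ℝ) ^ 2)) *
        Real.log (Real.exp 1 + Real.exp (-(n : ℝ)) * (y * Real.exp (1 + (n : ℝ)))) = 0) :
    (1 - (n - 1) * y) ^ 2 =
      (n - n * y ^ 2 + y * (1 - n + n ^ 2)) * (1 + Real.log (1 + y)) := by
  have hlog : Real.log (Real.exp 1 + Real.exp (-(n : ℝ)) * (y * Real.exp (1 + (n : ℝ)))) =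
      1 + Real.log (1 + y) := by
    have : Real.exp 1 + Real.exp (-(n : ℝ)) * (y * Real.exp (1 + (n : ℝ))) =
        Real.exp 1 * (1 + y) := by
      have h : Real.exp (-(n : ℝ)) * Real.exp (1 + (n : ℝ)) = Real.exp 1 := by
        rw [← Real.exp_add]
        ring_nf
      linear_combination y * h
    rw [this, Real.log_mul (Real.exp_ne_zero 1) (by linarith), Real.log_exp]
  have hsq : Real.exp (2 + 2 * (n : ℝ)) = Real.exp (1 + (n : ℝ)) ^ 2 := by
    rw [← Real.exp_nat_mul]
    push_cast
    ring_nf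
  rw [hlog, hsq] at hroot
  refine mul_left_cancel₀ (pow_ne_zero 2 (Real.exp_ne_zero (1 + (n : ℝ)))) ?_
  linear_combination hroot

lemma root_lower_bound {n : ℕ} (hn : 0 < n) {y : ℝ} (hy : 0 < y)
    (h : (1 - (n - 1) * y) ^ 2 =
      (n - n * y ^ 2 + y * (1 - n + n ^ 2)) * (1 + Real.log (1 + y))) :
    1 ≤ y ∧ (n = 2 → 3 / 2 ≤ y) ∧ (3 ≤ n → 2 ≤ y) := by
  have hL : 0 < Real.log (1 + y) := Real.log_pos (by linarith)
  have h3 : 3 ≤ n → 2 ≤ y := by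
    intro hn3
    have hn3 : (3 : ℝ) ≤ n := by exact_mod_cast hn3
    by_contra! hlt
    have hlog := half_le_log_one_add hy.le hlt.le
    generalize (n : ℝ) = m at *
    have hfac : 0 ≤ m - m * y ^ 2 + y * (1 - m + m ^ 2) := by
      nlinarith [mul_nonneg hy.le (sub_nonneg.2 hlt.le), mul_nonneg hy.le (by nlinarith : 0 ≤ 1 - 3 * m + m ^ 2)]
    have hmul : (m - m * y ^ 2 + y * (1 - m + m ^ 2)) * (1 + y / 2) ≤ (1 - (m - 1) * y) ^ 2 := by
      rw [h]
      gcongr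
    have hy2 : 0 < 2 - y := by linarith
    have e : (m - m * y ^ 2 + y * (1 - m + m ^ 2)) * (1 + y / 2) - (1 - (m - 1) * y) ^ 2 =
        (m - 1) * (2 - y) / 2 + (2 * m - 5) * y / 2 +
          y * (2 - y) * ((m ^ 2 + m + 1) / 2 + m * y / 2) := by
      ring
    have p1 : 0 < (m - 1) * (2 - y) / 2 := by
      have : 0 < m - 1 := by linarith
      positivity
    have p2 : 0 < (2 * m - 5) * y / 2 := by
      have : 0 < 2 * m - 5 := by linarith
      positivity
    have p3 : 0 ≤ y * (2 - y) * ((m ^ 2 + m + 1) / 2 + m * y / 2) := by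
      have : 0 < m := by linarith
      positivity
    linarith
  have h2 : n = 2 → 3 / 2 ≤ y := by
    rintro rfl
    by_contra! hlt
    push_cast at h
    nlinarith [mul_pos hy (sub_pos.2 hlt), mul_pos (mul_pos hy (sub_pos.2 hlt)) hL]
  refine ⟨?_, h2, h3⟩
  obtain rfl | hn2 | hn3 : n = 1 ∨ n = 2 ∨ 3 ≤ n := by omega
  · by_contra! hlt
    push_cast at h
    nlinarith [mul_pos hy (sub_pos.2 hlt), mul_pos (mul_pos hy (sub_pos.2 hlt)) hL]
  · linarith [h2 hn2]
  · linarith [h3 hn3]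

theorem stmt_9 (n : ℕ) (hn : 0 < n) (βn : ℝ) (hβn : 0 < βn)
    (hroot : (Real.exp (1 + (n : ℝ)) - βn * ((n : ℝ) - 1)) ^ 2 -
        (Real.exp (2 + 2 * (n : ℝ)) * (n : ℝ) - βn ^ 2 * (n : ℝ) +
          βn * Real.exp (1 + (n : ℝ)) * (1 - (n : ℝ) + (n : ℝ) ^ 2)) *
        Real.log (Real.exp 1 + Real.exp (-(n : ℝ)) * βn) = 0)
    (β : ℝ) (hβ : βn < β)
    (p : ℂ → ℂ) (hp : DifferentiableOn ℂ p unitDisk) (hp0 : p 0 = 1)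
    (hpne : ∀ z ∈ unitDisk, p z ≠ 0)
    (hsub : Subord (fun z => p z + (β : ℂ) * z * deriv p z / (p z) ^ (n + 1))
      Complex.exp) :
    Subord p Complex.exp := by
  obtain ⟨w, hw, hw0, hpw⟩ := exists_log_of_ne_zero hp hp0 hpne
  refine ⟨w, hw, hw0, ?_, hpw⟩
  by_contra! hex
  obtain ⟨z₀, hz₀, hne, hnorm, hle⟩ := exists_first_exit hw hw0 hex
  obtain ⟨k, hk, hjack⟩ := jack hw hw0 hz₀ hne hnorm hle
  obtain ⟨v, -, -, hv, hpv⟩ := hsub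
  obtain ⟨y, rfl⟩ : ∃ y, βn = y * Real.exp (1 + (n : ℝ)) :=
    ⟨βn / Real.exp (1 + (n : ℝ)), by field_simp⟩
  have hy : 0 < y := pos_of_mul_pos_left hβn (Real.exp_pos _).le
  obtain ⟨hy1, hy2, hy3⟩ := root_lower_bound hn hy (normalized_root hy hroot)
  have hlow := exp_one_le_norm_boundary hn hy1 hy2 hy3 (b := β * k) (by nlinarith) hnorm
  have hmem : unitDisk ∈ nhds z₀ := Metric.isOpen_ball.mem_nhds hz₀
  have hderiv : deriv p z₀ = exp (w z₀) * deriv w z₀ := by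
    have hev : p =ᶠ[nhds z₀] fun z => exp (w z) := by
      filter_upwards [hmem] with z hz using hpw z hz
    rw [hev.deriv_eq]
    exact (hw.differentiableAt hmem).hasDerivAt.cexp.deriv
  have hval : p z₀ + (β : ℂ) * z₀ * deriv p z₀ / (p z₀) ^ (n + 1) =
      exp (w z₀) + ((β * k : ℝ) : ℂ) * w z₀ * exp (-(n * w z₀)) := by
    have hE := Complex.exp_ne_zero (w z₀)
    rw [hderiv, hpw z₀ hz₀, Complex.exp_neg, Complex.exp_nat_mul]
    push_cast
    generalize exp (w z₀) = E at hE ⊢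
    field_simp
    linear_combination (E ^ (n + 1) * β) * hjack
  have hlt : ‖exp (v z₀)‖ < Real.exp 1 := by
    rw [Complex.norm_exp]
    exact Real.exp_lt_exp.2 ((Complex.re_le_norm _).trans_lt (hv z₀ hz₀))
  rw [← hpv z₀ hz₀] at hlt
  exact absurd (hval ▸ hlt) (not_lt.2 hlow)
end
end

section
/- Let β be a real number with β ≥ e − e⁻¹, and let p ∈ H₁ with p(z) ≠ 0 for all z ∈ 𝔻. If the function z ↦ p(z) + β·(z·p′(z))²/p(z)² is subordinate to z ↦ e^z on 𝔻, then p is subordinate to z ↦ e^z on 𝔻. -/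
open Complex

noncomputable section

open ComplexConjugate in
/-- On the unit circle, `Re (ζ ^ n) - (-1) ^ n` is at least `-n ^ 2 * (1 + Re ζ)`. -/
lemma neg_sq_mul_le_re_pow_sub {ζ : ℂ} (hζ : ‖ζ‖ = 1) (n : ℕ) :
    -((n : ℝ) ^ 2 * (1 + ζ.re)) ≤ (ζ ^ n).re - (-1) ^ n := by
  have hdist : ∀ m : ℕ, ‖ζ ^ m - (-1) ^ m‖ ≤ m * ‖ζ + 1‖ := by
    intro m
    induction m with
    | zero => simp
    | succ m ih =>
      have h : ζ ^ (m + 1) - (-1) ^ (m + 1) = (ζ ^ m - (-1) ^ m) * ζ + (-1) ^ m * (ζ + 1) := by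
        ring
      rw [h]
      refine (norm_add_le _ _).trans ?_
      rw [norm_mul, norm_mul, hζ]
      simp only [norm_pow, norm_neg, norm_one, one_pow]
      push_cast
      linarith
  have hsq : ∀ z : ℂ, ‖z‖ ^ 2 = z.re ^ 2 + z.im ^ 2 := by
    intro z
    rw [Complex.sq_norm, Complex.normSq_apply]
    ring
  have h1 := hsq ζ
  have hn : ‖ζ ^ n‖ = 1 := by rw [norm_pow, hζ, one_pow]
  have h2 := hsq (ζ ^ n)
  have h3 := pow_le_pow_left₀ (norm_nonneg _) (hdist n) 2
  rw [mul_pow, hsq, hsq] at h3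
  rw [hζ] at h1
  rw [hn] at h2
  have hre : (ζ ^ n).re ≤ 1 := hn ▸ Complex.re_le_norm _
  have hre' : -1 ≤ ζ.re := by
    have := Complex.abs_re_le_norm ζ
    rw [hζ] at this
    exact (abs_le.1 this).1
  rcases neg_one_pow_eq_or ℂ n with h | h <;> rcases neg_one_pow_eq_or ℝ n with h' | h'
  · rw [h] at h3
    simp only [Complex.sub_re, Complex.sub_im, Complex.add_re, Complex.add_im, Complex.one_re,
      Complex.one_im] at h3
    rw [h']
    nlinarith
  · exfalso
    have : ((-1 : ℝ) : ℂ) ^ n = 1 := by simpa using h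
    rw [← Complex.ofReal_pow, h'] at this
    norm_num at this
  · exfalso
    have : ((-1 : ℝ) : ℂ) ^ n = -1 := by simpa using h
    rw [← Complex.ofReal_pow, h'] at this
    norm_num at this
  · rw [h']
    have hnn : (-1 : ℝ) ≤ (ζ ^ n).re := by
      have := Complex.abs_re_le_norm (ζ ^ n)
      rw [hn] at this
      exact (abs_le.1 this).1
    have : 0 ≤ (n : ℝ) ^ 2 * (1 + ζ.re) := by
      have : 0 ≤ 1 + ζ.re := by linarith
      positivity
    linarith

lemma hasSum_pow_div_factorial_add_two (z : ℂ) :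
    HasSum (fun n : ℕ => z ^ (n + 2) / ((n + 2).factorial : ℂ)) (exp z - 1 - z) := by
  have h : HasSum (fun n : ℕ => z ^ n / (n.factorial : ℂ)) (exp z) := by
    rw [Complex.exp_eq_exp_ℂ]
    exact NormedSpace.expSeries_div_hasSum_exp z
  rw [← hasSum_nat_add_iff' 2] at h
  simpa [Finset.sum_range_succ, sub_sub] using h

lemma hasSum_div_factorial_succ :
    HasSum (fun n : ℕ => (n : ℝ) / ((n + 1).factorial : ℝ)) 1 := by
  have h : HasSum (fun n : ℕ => (1 : ℝ) ^ n / (n.factorial : ℝ)) (Real.exp 1) := by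
    rw [Real.exp_eq_exp_ℝ]
    exact NormedSpace.expSeries_div_hasSum_exp (1 : ℝ)
  have h' := (hasSum_nat_add_iff' 1).2 h
  have h2 := h.sub h'
  convert h2 using 1
  · rfl
  · ext n
    rw [Nat.factorial_succ]
    have : (n.factorial : ℝ) ≠ 0 := by positivity
    have : (n : ℝ) + 1 ≠ 0 := by positivity
    push_cast
    field_simp
    simp
  · simp

open ComplexConjugate in
/-- The minimum of `Re (conj ζ ^ 2 * (exp ζ - 1))` over the unit circle is attained at `-1`. -/
lemma exp_neg_one_sub_one_le_re {ζ : ℂ} (hζ : ‖ζ‖ = 1) :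
    (Real.exp 1)⁻¹ - 1 ≤ (conj ζ ^ 2 * (exp ζ - 1)).re := by
  have hc : conj ζ * ζ = 1 := by
    rw [mul_comm, Complex.mul_conj, Complex.normSq_eq_norm_sq, hζ]
    simp
  have h1 : HasSum (fun n : ℕ => ζ ^ n / ((n + 2).factorial : ℂ))
      (conj ζ ^ 2 * (exp ζ - 1) - conj ζ) := by
    convert (hasSum_pow_div_factorial_add_two ζ).mul_left (conj ζ ^ 2) using 1
    · rfl
    · ext n
      linear_combination (-(ζ ^ n / ((n + 2).factorial : ℂ)) * (conj ζ * ζ + 1)) * hc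
    · linear_combination conj ζ * hc
  have h2 : HasSum (fun n : ℕ => (-1 : ℂ) ^ n / ((n + 2).factorial : ℂ)) (exp (-1)) := by
    convert hasSum_pow_div_factorial_add_two (-1) using 1
    · ext n
      ring
    · ring
  have h3 := (Complex.reCLM.hasSum (h1.sub h2))
  have h4 := (hasSum_div_factorial_succ.mul_right (1 + ζ.re)).neg
  have hre : -1 ≤ ζ.re := by
    have := Complex.abs_re_le_norm ζ
    rw [hζ] at this
    exact (abs_le.1 this).1
  have h5 := hasSum_le (fun n => ?_) h4 h3
  · have he : (exp (-1)).re = (Real.exp 1)⁻¹ := by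
      rw [← Real.exp_neg, ← Complex.exp_ofReal_re]
      simp
    simp only [Complex.reCLM_apply, Complex.sub_re, Complex.conj_re, he] at h5
    linarith
  · have hp := neg_sq_mul_le_re_pow_sub hζ n
    have hterm : Complex.reCLM (ζ ^ n / ((n + 2).factorial : ℂ) -
        (-1 : ℂ) ^ n / ((n + 2).factorial : ℂ)) =
        ((ζ ^ n).re - (-1) ^ n) / ((n + 2).factorial : ℝ) := by
      have : (ζ ^ n / ((n + 2).factorial : ℂ) - (-1 : ℂ) ^ n / ((n + 2).factorial : ℂ)) =
        (ζ ^ n - (((-1 : ℝ) ^ n : ℝ) : ℂ)) / (((n + 2).factorial : ℝ) : ℂ) := by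
        push_cast
        ring
      rw [this, Complex.reCLM_apply, Complex.div_ofReal_re, Complex.sub_re, Complex.ofReal_re]
    change _ ≤ Complex.reCLM _
    rw [hterm, le_div_iff₀ (by positivity), Nat.factorial_succ (n + 1)]
    refine le_trans ?_ hp
    have hf : ((n + 1).factorial : ℝ) ≠ 0 := by positivity
    have : -((n : ℝ) / ((n + 1).factorial : ℝ) * (1 + ζ.re)) *
        (((n + 1 + 1) * (n + 1).factorial : ℕ) : ℝ) = -(n * (n + 2) * (1 + ζ.re)) := by
      push_cast
      field_simp
      ring
    rw [this]
    have : 0 ≤ (n : ℝ) * (1 + ζ.re) := mul_nonneg (by positivity) (by linarith)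
    nlinarith

/-- A function vanishing at `0` and nonpositive to its right has nonpositive derivative at `0`. -/
lemma HasDerivAt.nonpos_of_nonpos_right {g : ℝ → ℝ} {g' : ℝ} (hg : HasDerivAt g g' 0)
    (h0 : g 0 = 0) (h : ∀ t, 0 < t → g t ≤ 0) : g' ≤ 0 := by
  refine le_of_tendsto hg.tendsto_slope_zero_right ?_
  filter_upwards [self_mem_nhdsWithin] with t ht
  have ht' : 0 < t := ht
  have := h t ht'
  simp only [zero_add, h0, sub_zero, smul_eq_mul]
  exact mul_nonpos_of_nonneg_of_nonpos (by positivity) this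

open ComplexConjugate in
/-- Jack's lemma, for a boundary point at which the function has modulus one. -/
lemma jack_lemma {w : ℂ → ℂ} {z₀ w' : ℂ} (hw' : HasDerivAt w w' z₀)
    (h1 : ‖w z₀‖ = 1) (hle : ∀ z, ‖z‖ ≤ ‖z₀‖ → ‖w z‖ * ‖z₀‖ ≤ ‖z‖) (hz₀ : z₀ ≠ 0) :
    ∃ k : ℝ, 1 ≤ k ∧ z₀ * w' = k * w z₀ := by
  have hpos : 0 < ‖z₀‖ := norm_pos_iff.2 hz₀
  have key : ∀ a : ℂ, a.re ≤ 0 → (a * (conj (w z₀) * (z₀ * w'))).re ≤ a.re := by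
    intro a ha
    have hγ : HasDerivAt (fun t : ℝ => exp (t * a) * z₀) (a * z₀) 0 := by
      have h : HasDerivAt (fun t : ℝ => (t : ℂ) * a) a 0 := by
        simpa using (Complex.ofRealCLM.hasDerivAt (x := (0 : ℝ))).mul_const a
      simpa using h.cexp.mul_const z₀
    have hwγ : HasDerivAt (fun t : ℝ => w (exp (t * a) * z₀)) (w' * (a * z₀)) 0 := by
      have hw0 : HasDerivAt w w' (exp (((0 : ℝ) : ℂ) * a) * z₀) := by simpa using hw'
      exact hw0.comp (0 : ℝ) hγ
    have hN := hwγ.norm_sq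
    have hE : HasDerivAt (fun t : ℝ => Real.exp (t * a.re) ^ 2) (2 * a.re) 0 := by
      have := ((hasDerivAt_mul_const a.re (x := (0 : ℝ))).exp).pow 2
      exact this.congr_deriv (by simp)
    have := (hN.sub hE).nonpos_of_nonpos_right (by simp [h1]) ?_
    · simp only [Complex.ofReal_zero, zero_mul, Complex.exp_zero, one_mul, Complex.inner] at this
      have e : a * (conj (w z₀) * (z₀ * w')) = w' * (a * z₀) * conj (w z₀) := by ring
      rw [e]
      linarith
    · intro t ht
      have hn : ‖exp (t * a) * z₀‖ = Real.exp (t * a.re) * ‖z₀‖ := by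
        rw [norm_mul, Complex.norm_exp, Complex.re_ofReal_mul]
      have he : Real.exp (t * a.re) ≤ 1 := by
        rw [Real.exp_le_one_iff]
        exact mul_nonpos_of_nonneg_of_nonpos ht.le ha
      have hb := hle (exp (t * a) * z₀) (by
        rw [hn]
        exact mul_le_of_le_one_left hpos.le he)
      rw [hn] at hb
      have hb' := le_of_mul_le_mul_right hb hpos
      have := pow_le_pow_left₀ (norm_nonneg _) hb' 2
      simpa using this
  set K := conj (w z₀) * (z₀ * w') with hK
  have hr := key (-1) (by simp)
  have hi := key I (by simp)
  have hi' := key (-I) (by simp)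
  simp only [Complex.mul_re, Complex.neg_re, Complex.neg_im, Complex.I_re, Complex.I_im,
    Complex.one_re, Complex.one_im] at hr hi hi'
  refine ⟨K.re, by linarith, ?_⟩
  have hKre : ((K.re : ℝ) : ℂ) = K := Complex.ext (by simp) (by simp; linarith)
  have hc : w z₀ * conj (w z₀) = 1 := by
    rw [Complex.mul_conj, Complex.normSq_eq_norm_sq, h1]
    simp
  rw [hKre, hK]
  linear_combination (-(z₀ * w')) * hc

/-- If an analytic function vanishing at `0` leaves the unit disk, there is a first point of
modulus one, at which `z * w' z` is a real multiple `≥ 1` of `w z`. -/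
lemma exists_jack_point {w : ℂ → ℂ} (hw : DifferentiableOn ℂ w (Metric.ball 0 1))
    (hw0 : w 0 = 0) {z₁ : ℂ} (hz₁ : z₁ ∈ Metric.ball (0 : ℂ) 1) (h : 1 ≤ ‖w z₁‖) :
    ∃ z₀ ∈ Metric.ball (0 : ℂ) 1, ‖w z₀‖ = 1 ∧
      ∃ k : ℝ, 1 ≤ k ∧ z₀ * deriv w z₀ = k * w z₀ := by
  have hsub : Metric.closedBall (0 : ℂ) ‖z₁‖ ⊆ Metric.ball 0 1 :=
    Metric.closedBall_subset_ball (by simpa using hz₁)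
  have hcont := hw.continuousOn.mono hsub
  have hcomp : IsCompact (Metric.closedBall (0 : ℂ) ‖z₁‖ ∩ {z | 1 ≤ ‖w z‖}) := by
    refine (isCompact_closedBall _ _).of_isClosed_subset ?_ Set.inter_subset_left
    exact hcont.norm.preimage_isClosed_of_isClosed Metric.isClosed_closedBall isClosed_Ici
  obtain ⟨z₀, ⟨hz₀, hge⟩, hmin⟩ :=
    hcomp.exists_isMinOn ⟨z₁, by simp, h⟩ continuous_norm.continuousOn
  have hge' : 1 ≤ ‖w z₀‖ := hge
  have hne : z₀ ≠ 0 := by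
    rintro rfl
    rw [hw0, norm_zero] at hge'
    linarith
  have hpos : 0 < ‖z₀‖ := norm_pos_iff.2 hne
  have hz₀' : ‖z₀‖ ≤ ‖z₁‖ := by simpa using hz₀
  have hsub₀ : Metric.closedBall (0 : ℂ) ‖z₀‖ ⊆ Metric.ball 0 1 :=
    (Metric.closedBall_subset_closedBall hz₀').trans hsub
  have hlt : ∀ z ∈ Metric.ball (0 : ℂ) ‖z₀‖, ‖w z‖ < 1 := by
    intro z hz
    by_contra! hcon
    have hz' : ‖z‖ < ‖z₀‖ := by simpa using hz
    have : ‖z₀‖ ≤ ‖z‖ := hmin ⟨by simpa using hz'.le.trans hz₀', hcon⟩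
    linarith
  have hschwarz : ∀ z ∈ Metric.ball (0 : ℂ) ‖z₀‖, ‖w z‖ * ‖z₀‖ ≤ ‖z‖ := by
    intro z hz
    have := Complex.dist_le_div_mul_dist_of_mapsTo_ball (f := w) (c := 0) (R₁ := ‖z₀‖) (R₂ := 1)
      (hw.mono (Metric.ball_subset_closedBall.trans hsub₀))
      (fun z hz => by simpa [hw0] using (hlt z hz).le) hz
    rw [hw0, dist_zero_right, dist_zero_right, div_mul_eq_mul_div, one_mul,
      le_div_iff₀ hpos] at this
    exact this
  have hle : ∀ z, ‖z‖ ≤ ‖z₀‖ → ‖w z‖ * ‖z₀‖ ≤ ‖z‖ := by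
    intro z hz
    have hcl := closure_ball (0 : ℂ) hpos.ne'
    refine le_on_closure (s := Metric.ball (0 : ℂ) ‖z₀‖) (f := fun z => ‖w z‖ * ‖z₀‖)
      (g := fun z => ‖z‖) hschwarz ?_ continuous_norm.continuousOn ?_
    · rw [hcl]
      exact (hw.continuousOn.mono hsub₀).norm.mul continuousOn_const
    · rw [hcl]
      simpa using hz
  have h1 : ‖w z₀‖ = 1 :=
    le_antisymm (by nlinarith [hle z₀ le_rfl]) hge'
  have hmem : z₀ ∈ Metric.ball (0 : ℂ) 1 := hsub hz₀
  exact ⟨z₀, hmem, h1, jack_lemma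
    ((hw.differentiableAt (Metric.isOpen_ball.mem_nhds hmem)).hasDerivAt) h1 hle hne⟩

/-- A nonvanishing analytic function on the unit disk with value `1` at `0` has an analytic
logarithm vanishing at `0`. -/
lemma exists_log_on_ball {p : ℂ → ℂ} (hp : DifferentiableOn ℂ p (Metric.ball 0 1))
    (hp0 : p 0 = 1) (hpne : ∀ z ∈ Metric.ball (0 : ℂ) 1, p z ≠ 0) :
    ∃ w : ℂ → ℂ, w 0 = 0 ∧ (∀ z ∈ Metric.ball (0 : ℂ) 1, HasDerivAt w (deriv p z / p z) z) ∧
      ∀ z ∈ Metric.ball (0 : ℂ) 1, p z = exp (w z) := by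
  obtain ⟨w, hw0, hw⟩ :=
    ((hp.deriv Metric.isOpen_ball).div hp hpne).isExactOn_ball.with_val_at 0 0
  refine ⟨w, hw0, hw, fun z hz => ?_⟩
  have hd : ∀ x ∈ Metric.ball (0 : ℂ) 1, HasDerivAt (fun x => p x * exp (-w x)) 0 x := by
    intro x hx
    have hpx := (hp.differentiableAt (Metric.isOpen_ball.mem_nhds hx)).hasDerivAt
    have h := hpx.mul (hw x hx).neg.cexp
    refine h.congr_deriv ?_
    have := hpne x hx
    simp only [Pi.div_apply, Pi.neg_apply]
    field_simp
    ring
  have hconst := Metric.isOpen_ball.is_const_of_deriv_eq_zero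
    (convex_ball (0 : ℂ) 1).isPreconnected
    (fun x hx => (hd x hx).differentiableAt.differentiableWithinAt)
    (fun x hx => (hd x hx).deriv) hz (Metric.mem_ball_self one_pos)
  simp only [hp0, hw0, neg_zero, Complex.exp_zero, mul_one] at hconst
  rw [Complex.exp_neg] at hconst
  exact (mul_inv_eq_one₀ (Complex.exp_ne_zero _)).1 hconst

theorem stmt_12 (β : ℝ) (hβ : Real.exp 1 - (Real.exp 1)⁻¹ ≤ β)
    (p : ℂ → ℂ) (hp : DifferentiableOn ℂ p unitDisk) (hp0 : p 0 = 1)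
    (hpne : ∀ z ∈ unitDisk, p z ≠ 0)
    (hsub : Subord (fun z => p z + (β : ℂ) * (z * deriv p z) ^ 2 / (p z) ^ 2)
      Complex.exp) :
    Subord p Complex.exp := by
  obtain ⟨w, hw0, hwd, hpw⟩ := exists_log_on_ball hp hp0 hpne
  have hw : DifferentiableOn ℂ w unitDisk :=
    fun z hz => (hwd z hz).differentiableAt.differentiableWithinAt
  refine ⟨w, hw, hw0, fun z₁ hz₁ => ?_, hpw⟩
  by_contra! hcon
  obtain ⟨z₀, hz₀, h1, k, hk, hjack⟩ := exists_jack_point hw hw0 hz₁ hcon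
  obtain ⟨ω, -, -, hω, hωeq⟩ := hsub
  have hval := hωeq z₀ hz₀
  have hlog : z₀ * deriv p z₀ / p z₀ = k * w z₀ := by
    rw [← hjack, (hwd z₀ hz₀).deriv, mul_div_assoc]
  have hval' : exp (w z₀) - 1 + β * k ^ 2 * w z₀ ^ 2 = exp (ω z₀) - 1 := by
    rw [← hval]
    simp only
    rw [mul_div_assoc, ← div_pow, hlog, hpw z₀ hz₀]
    ring
  have hupper : ‖exp (ω z₀) - 1‖ < Real.exp 1 - 1 := by
    have := Complex.norm_exp_sub_sum_le_exp_norm_sub_sum (ω z₀) 1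
    simp only [Finset.range_one, Finset.sum_singleton, pow_zero, Nat.factorial_zero, Nat.cast_one,
      div_one] at this
    have := Real.exp_lt_exp.2 (hω z₀ hz₀)
    linarith
  have hc : w z₀ * (starRingEnd ℂ) (w z₀) = 1 := by
    rw [Complex.mul_conj, Complex.normSq_eq_norm_sq, h1]
    simp
  have hlower := exp_neg_one_sub_one_le_re h1
  have hsplit : (starRingEnd ℂ) (w z₀) ^ 2 * (exp (ω z₀) - 1) =
      (starRingEnd ℂ) (w z₀) ^ 2 * (exp (w z₀) - 1) + ((β * k ^ 2 : ℝ) : ℂ) := by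
    rw [← hval']
    push_cast
    linear_combination (β * k ^ 2 * (w z₀ * (starRingEnd ℂ) (w z₀) + 1) : ℂ) * hc
  have hre := Complex.re_le_norm ((starRingEnd ℂ) (w z₀) ^ 2 * (exp (ω z₀) - 1))
  rw [norm_mul, norm_pow, RCLike.norm_conj, h1, one_pow, one_mul, hsplit, Complex.add_re,
    Complex.ofReal_re] at hre
  have hβ0 : 0 ≤ β := by
    have h2 : (1 : ℝ) ≤ Real.exp 1 := Real.one_le_exp zero_le_one
    have h3 : (Real.exp 1)⁻¹ ≤ 1 := inv_le_one_of_one_le₀ h2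
    linarith
  have hβk : β ≤ β * k ^ 2 := le_mul_of_one_le_right hβ0 (one_le_pow₀ hk)
  linarith
end
end

section
/- Let β be a real number with β ≥ e² + e⁻¹ − e + 1, and let p ∈ H₁. If the function z ↦ p(z)² + p(z) − 1 + β·z·p′(z) is subordinate to z ↦ e^z on 𝔻, then p is subordinate to z ↦ e^z on 𝔻. -/
open Complex

noncomputable section

lemma Real.one_add_sq_div_two_le_cosh (x : ℝ) : 1 + x ^ 2 / 2 ≤ Real.cosh x := by
  have h1 : Real.cosh x = 1 + 2 * Real.sinh (x / 2) ^ 2 := by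
    have h := Real.cosh_two_mul (x / 2)
    rw [mul_div_cancel₀ x two_ne_zero, Real.cosh_sq] at h
    linarith
  have h2 : (x / 2) ^ 2 ≤ Real.sinh (x / 2) ^ 2 := by
    rw [sq_le_sq, Real.abs_sinh]
    exact Real.self_le_sinh_iff.2 (abs_nonneg _)
  nlinarith

lemma Real.sinh_one_sub_le_mul_sinh {c : ℝ} (hc : |c| ≤ 1) :
    Real.sinh 1 - Real.cosh 1 * (1 - c ^ 2) ≤ c * Real.sinh c := by
  have key : ∀ x : ℝ, 0 ≤ x → x ≤ 1 →
      Real.sinh 1 - Real.cosh 1 * (1 - x ^ 2) ≤ x * Real.sinh x := by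
    intro x hx0 hx1
    have hmvt : Real.sinh 1 - Real.sinh x ≤ Real.cosh 1 * (1 - x) := by
      refine (convex_Icc (0 : ℝ) 1).image_sub_le_mul_sub_of_deriv_le
        Real.continuous_sinh.continuousOn Real.differentiable_sinh.differentiableOn ?_
        x ⟨hx0, hx1⟩ 1 ⟨zero_le_one, le_rfl⟩ hx1
      intro y hy
      rw [interior_Icc] at hy
      rw [Real.deriv_sinh, Real.cosh_le_cosh, abs_of_pos hy.1, abs_one]
      exact hy.2.le
    have hsc := Real.sinh_lt_cosh 1
    nlinarith [mul_le_mul_of_nonneg_left hmvt hx0,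
      mul_nonneg (sub_nonneg.2 hx1) (sub_nonneg.2 hsc.le)]
  have h := key |c| (abs_nonneg c) hc
  rw [sq_abs, ← Real.abs_sinh, ← abs_mul] at h
  have hpos : 0 ≤ c * Real.sinh c := by
    rcases le_total 0 c with h0 | h0
    · exact mul_nonneg h0 (Real.sinh_nonneg_iff.2 h0)
    · exact mul_nonneg_of_nonpos_of_nonpos h0 (Real.sinh_nonpos_iff.2 h0)
  rwa [abs_of_nonneg hpos] at h

lemma Real.sq_sub_le_mul_sin (s : ℝ) : s ^ 2 - s ^ 4 / 6 ≤ s * Real.sin s := by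
  have key : ∀ x : ℝ, 0 ≤ x → x ^ 2 - x ^ 4 / 6 ≤ x * Real.sin x := fun x hx => by
    nlinarith [mul_le_mul_of_nonneg_left (Real.sin_ge_sub_cube hx) hx]
  rcases le_total 0 s with h | h
  · exact key s h
  · simpa [Even.neg_pow (by decide : Even 2), Even.neg_pow (by decide : Even 4)] using
      key (-s) (neg_nonneg.2 h)

lemma Real.exp_one_sub_le_of_sq_add_sq_eq_one {c s : ℝ} (h : c ^ 2 + s ^ 2 = 1) :
    Real.exp (1 - c) ≤ Real.exp 1 ^ 2 + (Real.exp 1)⁻¹ - Real.exp 1 + 1 + c +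
      2 * (c * (Real.sinh c * Real.cos s) + s * (Real.cosh c * Real.sin s)) := by
  have hc : |c| ≤ 1 := by rw [← sq_le_one_iff_abs_le_one]; nlinarith [sq_nonneg s]
  obtain ⟨hc1, hc2⟩ := abs_le.1 hc
  have e1 := Real.exp_one_gt_d9
  have e2 := Real.exp_one_lt_d9
  have hinv1 : (Real.exp 1)⁻¹ ≤ 0.36788 := by
    rw [inv_le_comm₀ (by positivity) (by norm_num)]; norm_num; linarith
  have hinv2 : 0.36787 ≤ (Real.exp 1)⁻¹ := by
    rw [le_inv_comm₀ (by norm_num) (by positivity)]; norm_num; linarith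
  have hsinh : Real.sinh 1 = (Real.exp 1 - (Real.exp 1)⁻¹) / 2 := by
    rw [Real.sinh_eq, Real.exp_neg]
  have hcosh : Real.cosh 1 = (Real.exp 1 + (Real.exp 1)⁻¹) / 2 := by
    rw [Real.cosh_eq, Real.exp_neg]
  -- the exponential lies below its chord
  have hchord : Real.exp (1 - c) ≤ (1 - c) / 2 * Real.exp 1 ^ 2 + (1 + c) / 2 := by
    have := convexOn_exp.2 (Set.mem_univ 2) (Set.mem_univ 0)
      (by linarith : 0 ≤ (1 - c) / 2) (by linarith : 0 ≤ (1 + c) / 2) (by ring)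
    simp only [smul_eq_mul, mul_zero, add_zero, Real.exp_zero, mul_one] at this
    rw [div_mul_cancel₀ _ two_ne_zero] at this
    rwa [← Real.exp_nat_mul, Nat.cast_ofNat, mul_one]
  have hcos := Real.one_sub_sq_div_two_le_cos (x := s)
  have hcos1 := Real.cos_le_one s
  have hsin := Real.sq_sub_le_mul_sin s
  have hA := Real.sinh_one_sub_le_mul_sinh hc
  have hB := Real.one_add_sq_div_two_le_cosh c
  obtain ⟨u, hu⟩ : ∃ u, u = s ^ 2 := ⟨_, rfl⟩
  have hcu : c ^ 2 = 1 - u := by linarith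
  have hs4 : s ^ 4 = u ^ 2 := by rw [hu]; ring
  rw [← hu] at hcos hsin
  rw [hs4] at hsin
  rw [hcu] at hA hB
  have hu0 : 0 ≤ u := hu ▸ sq_nonneg s
  have hu1 : u ≤ 1 := by nlinarith [sq_nonneg c]
  have h1 : Real.sinh 1 * (1 - u / 2) - Real.cosh 1 * u ≤ c * Real.sinh c * Real.cos s := by
    have hcos0 : 0 ≤ Real.cos s := by linarith
    have a1 := mul_le_mul_of_nonneg_right hA hcos0
    have a2 : 0 ≤ Real.sinh 1 * (Real.cos s - (1 - u / 2)) :=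
      mul_nonneg (by linarith) (by linarith)
    have a3 : 0 ≤ Real.cosh 1 * u * (1 - Real.cos s) :=
      mul_nonneg (mul_nonneg (by linarith) hu0) (by linarith)
    linarith
  have h2 : u * (3 / 2 - 3 / 4 * u) ≤ s * Real.sin s * Real.cosh c := by
    have b0 : 0 ≤ u - u ^ 2 / 6 := by nlinarith
    have b1 := mul_le_mul hsin hB (by linarith) (b0.trans hsin)
    nlinarith [pow_nonneg hu0 3]
  have h3 : Real.sinh 1 * (u / 2) + Real.cosh 1 * u ≤ 2.131 * u := by
    rw [hsinh, hcosh]; nlinarith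
  have h4 : 2 * u * (0.631 + 3 / 4 * u) ≤ (1 + c) * 4.19 := by
    have hu' : u = (1 + c) * (1 - c) := by linarith
    have hq : 2 * (1 - c) * (0.631 + 3 / 4 * u) ≤ 4.19 := by
      rw [hu']
      nlinarith [sq_nonneg (c + 1 / 2), mul_nonneg (by linarith : 0 ≤ 1 + c) (sq_nonneg (c + 1/2)),
        mul_nonneg (by linarith : 0 ≤ 1 - c) (sq_nonneg (c + 1/2))]
    calc 2 * u * (0.631 + 3 / 4 * u) = (1 + c) * (2 * (1 - c) * (0.631 + 3 / 4 * u)) := by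
          nth_rewrite 1 [hu']; ring
      _ ≤ _ := mul_le_mul_of_nonneg_left hq (by linarith)
  have h5 : (1 + c) * 4.19 ≤ (1 + c) * (1 + (Real.exp 1 ^ 2 - 1) / 2) :=
    mul_le_mul_of_nonneg_left (by nlinarith) (by linarith)
  nlinarith

/-- On the boundary of `exp 𝔻` the admissibility condition holds for any multiplier whose real
part is at least one. -/
lemma exp_one_le_norm_boundary_s19 {β : ℝ}
    (hβ : Real.exp 1 ^ 2 + (Real.exp 1)⁻¹ - Real.exp 1 + 1 ≤ β) {ζ d : ℂ}
    (hζ : ‖ζ‖ = 1) (hd : 1 ≤ ((starRingEnd ℂ) ζ * d).re) :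
    Real.exp 1 ≤ ‖exp ζ ^ 2 + exp ζ - 1 + β * (exp ζ * d)‖ := by
  have hβ0 : 0 ≤ β := by
    have := Real.exp_one_gt_d9
    have : 0 < (Real.exp 1)⁻¹ := by positivity
    nlinarith
  have hcs : ζ.re ^ 2 + ζ.im ^ 2 = 1 := by
    have := Complex.sq_norm ζ
    rw [hζ, normSq_apply] at this
    linarith
  have hfac : exp ζ ^ 2 + exp ζ - 1 + β * (exp ζ * d) =
      exp ζ * (1 + 2 * sinh ζ + β * d) := by
    have : exp ζ * exp (-ζ) = 1 := by rw [← exp_add]; simp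
    rw [two_sinh]
    linear_combination this
  have hre : (sinh ζ).re = Real.sinh ζ.re * Real.cos ζ.im ∧
      (sinh ζ).im = Real.cosh ζ.re * Real.sin ζ.im := by
    constructor
    · rw [sinh, Real.sinh_eq]
      simp [exp_re]
      ring
    · rw [sinh, Real.cosh_eq]
      simp [exp_im]
      ring
  have hlow : Real.exp (1 - ζ.re) ≤ ‖1 + 2 * sinh ζ + β * d‖ := by
    calc Real.exp (1 - ζ.re) ≤ ((starRingEnd ℂ) ζ * (1 + 2 * sinh ζ + β * d)).re := by
          have h1 := Real.exp_one_sub_le_of_sq_add_sq_eq_one hcs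
          have h2 := mul_le_mul_of_nonneg_left hd hβ0
          have h3 : ((starRingEnd ℂ) ζ * (1 + 2 * sinh ζ + β * d)).re = ζ.re +
              2 * (ζ.re * (sinh ζ).re + ζ.im * (sinh ζ).im) +
              β * ((starRingEnd ℂ) ζ * d).re := by
            simp
            ring
          rw [h3, hre.1, hre.2]
          linarith
      _ ≤ ‖(starRingEnd ℂ) ζ * (1 + 2 * sinh ζ + β * d)‖ := re_le_norm _
      _ = _ := by rw [norm_mul, RCLike.norm_conj, hζ, one_mul]
  rw [hfac, norm_mul, norm_exp]
  calc Real.exp 1 = Real.exp ζ.re * Real.exp (1 - ζ.re) := by rw [← Real.exp_add]; ring_nf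
    _ ≤ _ := by gcongr

lemma exp_image_closedBall_subset_slitPlane : exp '' Metric.closedBall 0 1 ⊆ slitPlane := by
  rintro _ ⟨v, hv, rfl⟩
  have hv' : |v.im| ≤ 1 := (abs_im_le_norm v).trans (by simpa using hv)
  refine Or.inl ?_
  rw [exp_re]
  refine mul_pos (Real.exp_pos _) (Real.cos_pos_of_mem_Ioo ?_)
  have := Real.pi_gt_three
  constructor <;> linarith [(abs_le.1 hv').1, (abs_le.1 hv').2]

lemma log_exp_of_norm_le_one {v : ℂ} (hv : ‖v‖ ≤ 1) : log (exp v) = v := by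
  have hv' := abs_le.1 ((abs_im_le_norm v).trans hv)
  have := Real.pi_gt_three
  exact log_exp (by linarith [hv'.1]) (by linarith [hv'.2])

/-- The half of Jack's lemma bounding the real part of the multiplier: if `q` fixes the origin,
maps a disk into the unit disk and reaches the unit circle at a boundary point `z₀`, then the
logarithmic derivative of `q` at `z₀` has real part at least one. -/
lemma one_le_re_of_mapsTo_ball {q : ℂ → ℂ} {z₀ q' : ℂ} (hz₀ : z₀ ≠ 0)
    (hq : DifferentiableOn ℂ q (Metric.ball 0 ‖z₀‖)) (hq0 : q 0 = 0)
    (hmaps : ∀ z ∈ Metric.ball 0 ‖z₀‖, ‖q z‖ ≤ 1) (hz : ‖q z₀‖ = 1)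
    (hd : HasDerivAt q q' z₀) : 1 ≤ ((starRingEnd ℂ) (q z₀) * (z₀ * q')).re := by
  have hr : 0 < ‖z₀‖ := norm_pos_iff.2 hz₀
  have hschwarz : ∀ t ∈ Set.Ico (0 : ℝ) 1, ‖q (t * z₀)‖ ≤ t := by
    intro t ht
    have hmem : (t * z₀ : ℂ) ∈ Metric.ball 0 ‖z₀‖ := by
      rw [mem_ball_zero_iff, norm_mul, norm_real, Real.norm_of_nonneg ht.1]
      exact mul_lt_of_lt_one_left hr ht.2
    have := dist_le_div_mul_dist_of_mapsTo_ball (R₂ := 1) hq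
      (fun z hz => by simpa [hq0] using hmaps z hz) hmem
    rw [hq0, dist_zero_right, dist_zero_right, norm_mul, norm_real,
      Real.norm_of_nonneg ht.1] at this
    calc _ ≤ _ := this
      _ = t := by field_simp
  have hpath : HasDerivAt (fun t : ℝ => (starRingEnd ℂ) (q z₀) * q (t * z₀))
      ((starRingEnd ℂ) (q z₀) * (z₀ * q')) 1 := by
    have h1 : HasDerivAt (fun t : ℂ => t * z₀) z₀ ((1 : ℝ) : ℂ) := by
      simpa using (hasDerivAt_id ((1 : ℝ) : ℂ)).mul_const z₀
    have hd' : HasDerivAt q q' (((1 : ℝ) : ℂ) * z₀) := by simpa using hd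
    have h2 := ((hd'.comp ((1 : ℝ) : ℂ) h1).comp_ofReal).const_mul ((starRingEnd ℂ) (q z₀))
    rw [mul_comm q'] at h2
    exact h2
  have hre : HasDerivAt (fun t : ℝ => ((starRingEnd ℂ) (q z₀) * q (t * z₀)).re)
      ((starRingEnd ℂ) (q z₀) * (z₀ * q')).re 1 :=
    (reCLM.hasFDerivAt.comp_hasDerivAt (1 : ℝ) hpath)
  have hone : ((starRingEnd ℂ) (q z₀) * q ((1 : ℝ) * z₀)).re = 1 := by
    rw [ofReal_one, one_mul, mul_comm, mul_conj, ofReal_re, normSq_eq_norm_sq, hz, one_pow]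
  refine ge_of_tendsto ((hasDerivWithinAt_iff_tendsto_slope' Set.self_notMem_Iio).1
    (hre.hasDerivWithinAt (s := Set.Iio 1))) ?_
  filter_upwards [Ico_mem_nhdsLT (zero_lt_one' ℝ)] with t ht
  rw [slope_def_field, hone, le_div_iff_of_neg (by linarith [ht.2])]
  have : ((starRingEnd ℂ) (q z₀) * q (t * z₀)).re ≤ t := by
    refine (re_le_norm _).trans ?_
    rw [norm_mul, RCLike.norm_conj, hz, one_mul]
    exact hschwarz t ht
  linarith

lemma subord_exp_of_forall_mem {p : ℂ → ℂ} (hp : DifferentiableOn ℂ p unitDisk) (hp0 : p 0 = 1)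
    (h : ∀ z ∈ unitDisk, p z ∈ exp '' Metric.ball 0 1) : Subord p exp := by
  refine ⟨fun z => log (p z), ?_, by simp [hp0], ?_, ?_⟩
  · refine hp.clog fun z hz => ?_
    exact exp_image_closedBall_subset_slitPlane (Set.image_mono Metric.ball_subset_closedBall (h z hz))
  · intro z hz
    obtain ⟨v, hv, hvz⟩ := h z hz
    rw [mem_ball_zero_iff] at hv
    simpa only [← hvz, log_exp_of_norm_le_one hv.le] using hv
  · intro z hz
    obtain ⟨v, hv, hvz⟩ := h z hz
    rw [exp_log (hvz ▸ exp_ne_zero v)]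

lemma isOpen_exp_image_ball : IsOpen (exp '' Metric.ball 0 1) := by
  have h : IsOpenMap exp := by
    refine IsOpenMap.of_nhds_le fun x => ?_
    exact ((hasStrictDerivAt_exp x).map_nhds_eq (exp_ne_zero x)).ge
  exact h _ Metric.isOpen_ball

/-- A function that leaves an open set containing its value at the origin does so first at some
point `z₀`. -/
lemma exists_first_exit_s19 {p : ℂ → ℂ} {U : Set ℂ} (hp : ContinuousOn p unitDisk) (hU : IsOpen U)
    (h0 : p 0 ∈ U) {z₁ : ℂ} (hz₁ : z₁ ∈ unitDisk) (hpz₁ : p z₁ ∉ U) :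
    ∃ z₀ ∈ unitDisk, z₀ ≠ 0 ∧ p z₀ ∉ U ∧ p z₀ ∈ closure U ∧
      ∀ z ∈ Metric.ball 0 ‖z₀‖, p z ∈ U := by
  have hsub : Metric.closedBall (0 : ℂ) ‖z₁‖ ⊆ unitDisk :=
    Metric.closedBall_subset_ball (by simpa [unitDisk] using hz₁)
  have hcomp : IsCompact (Metric.closedBall (0 : ℂ) ‖z₁‖ ∩ p ⁻¹' Uᶜ) :=
    (isCompact_closedBall _ _).of_isClosed_subset
      ((hp.mono hsub).preimage_isClosed_of_isClosed Metric.isClosed_closedBall hU.isClosed_compl)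
      Set.inter_subset_left
  obtain ⟨z₀, ⟨hz₀, hpz₀⟩, hmin⟩ := hcomp.exists_isMinOn
    ⟨z₁, by simp, hpz₁⟩ continuous_norm.continuousOn
  have hne : z₀ ≠ 0 := by
    rintro rfl
    exact hpz₀ h0
  have hin : ∀ z ∈ Metric.ball 0 ‖z₀‖, p z ∈ U := by
    intro z hz
    by_contra hcon
    rw [mem_ball_zero_iff] at hz
    have hle : ‖z₀‖ ≤ ‖z‖ :=
      hmin ⟨mem_closedBall_zero_iff.2 (hz.le.trans (mem_closedBall_zero_iff.1 hz₀)), hcon⟩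
    exact absurd hz hle.not_gt
  refine ⟨z₀, hsub hz₀, hne, hpz₀, ?_, hin⟩
  have hcl : z₀ ∈ closure (Metric.ball (0 : ℂ) ‖z₀‖) := by
    rw [closure_ball _ (norm_ne_zero_iff.2 hne)]
    simp
  have hcont : ContinuousWithinAt p (Metric.ball 0 ‖z₀‖) z₀ :=
    ((hp z₀ (hsub hz₀)).continuousAt (Metric.isOpen_ball.mem_nhds (hsub hz₀))).continuousWithinAt
  exact hcont.mem_closure hcl hin

theorem stmt_19 (β : ℝ)
    (hβ : Real.exp 1 ^ 2 + (Real.exp 1)⁻¹ - Real.exp 1 + 1 ≤ β)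
    (p : ℂ → ℂ) (hp : DifferentiableOn ℂ p unitDisk) (hp0 : p 0 = 1)
    (hsub : Subord (fun z => (p z) ^ 2 + p z - 1 + (β : ℂ) * z * deriv p z)
      Complex.exp) :
    Subord p Complex.exp := by
  refine subord_exp_of_forall_mem hp hp0 ?_
  by_contra! hcon
  obtain ⟨z₁, hz₁, hpz₁⟩ := hcon
  obtain ⟨z₀, hz₀, hne, hout, hcl, hin⟩ := exists_first_exit_s19 hp.continuousOn
    isOpen_exp_image_ball (by rw [hp0]; exact ⟨0, by simp, exp_zero⟩) hz₁ hpz₁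
  have hcl' : p z₀ ∈ exp '' Metric.closedBall 0 1 :=
    closure_minimal (Set.image_mono Metric.ball_subset_closedBall)
      ((isCompact_closedBall _ _).image continuous_exp).isClosed hcl
  obtain ⟨ζ, hζ, hζp⟩ := id hcl'
  rw [mem_closedBall_zero_iff] at hζ
  have hζ1 : ‖ζ‖ = 1 := by
    refine le_antisymm hζ (not_lt.1 fun hlt => hout ⟨ζ, by simpa using hlt, hζp⟩)
  have hball : Metric.ball (0 : ℂ) ‖z₀‖ ⊆ unitDisk :=
    Metric.ball_subset_ball (by simpa [unitDisk] using (mem_ball_zero_iff.1 hz₀).le)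
  have hpd : HasDerivAt p (deriv p z₀) z₀ :=
    (hp.differentiableAt (Metric.isOpen_ball.mem_nhds hz₀)).hasDerivAt
  have hlogz₀ : log (p z₀) = ζ := by rw [← hζp, log_exp_of_norm_le_one hζ]
  have hjack := one_le_re_of_mapsTo_ball (q := fun z => log (p z)) hne
    ((hp.mono hball).clog fun z hz =>
      exp_image_closedBall_subset_slitPlane (Set.image_mono Metric.ball_subset_closedBall (hin z hz)))
    (by simp [hp0])
    (fun z hz => by
      obtain ⟨v, hv, hvz⟩ := hin z hz
      rw [mem_ball_zero_iff] at hv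
      simpa only [← hvz, log_exp_of_norm_le_one hv.le] using hv.le)
    (by simpa only [hlogz₀] using hζ1)
    (hpd.clog (exp_image_closedBall_subset_slitPlane hcl'))
  simp only [hlogz₀] at hjack
  have hnorm := exp_one_le_norm_boundary_s19 hβ hζ1 hjack
  obtain ⟨w, -, -, hw, hweq⟩ := hsub
  have hval : exp ζ ^ 2 + exp ζ - 1 + β * (exp ζ * (z₀ * (deriv p z₀ / p z₀))) =
      exp (w z₀) := by
    have hpz₀ : p z₀ ≠ 0 := hζp ▸ exp_ne_zero ζ
    rw [← hweq z₀ hz₀, hζp]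
    field_simp
  rw [hval, norm_exp, Real.exp_le_exp] at hnorm
  exact absurd ((re_le_norm _).trans_lt (hw z₀ hz₀)) hnorm.not_gt
end
end
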